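/- arXiv:2203.02763 — 2 statements merged into one kernel-verified Lean document; each statement's English description precedes it below -/
import Mathlib

section
/- There are absolute constants c₀ ≥ 10 and κ > 0 such that for every real c ≥ c₀ the following holds. Let m be a sufficiently large integer and let n = (1 − ε)·m be an integer with m^{−1/3} ≤ ε ≤ 1/c. Fix any history-independent insertion/deletion model at size n on m slots. Draw r uniform in {1, …, n+1}, start from A ∼ 𝒞_n, and perform an insertion at rank r followed by a deletion at rank n+1. Then the expected total cost of the two operations is at least κ·Σ_{j ∈ J} 1/(Δ_j + 1/j). -/
open scoped BigOperators Classical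

/-- Read slot `i` (mod `m`) of a cyclic array of `m` boolean slots. -/
def cyc (m : ℕ) (A : Fin m → Bool) (i : ℕ) : Bool :=
  if h : 0 < m then A ⟨i % m, Nat.mod_lt i h⟩ else false

/-- Number of occupied slots among the `j` cyclically consecutive slots
`p, p+1, …, p+j-1`. -/
def blockCount (m : ℕ) (A : Fin m → Bool) (p j : ℕ) : ℕ :=
  ((Finset.range j).filter (fun t => cyc m A (p + t) = true)).card

/-- Density of the `j`-block starting at slot `p`. -/
noncomputable def blockDensity (m : ℕ) (A : Fin m → Bool) (p j : ℕ) : ℝ :=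
  (blockCount m A p j : ℝ) / j

/-- A block is live (w.r.t. constant `c` and sparsity `ε`) if its density is
at least `1 - c·ε`. -/
def IsLive (c ε : ℝ) (m : ℕ) (A : Fin m → Bool) (p j : ℕ) : Prop :=
  1 - c * ε ≤ blockDensity m A p j

/-- Imbalance of a `j`-block (for even `j`): difference of the densities of its
two halves. -/
noncomputable def imbalance (m : ℕ) (A : Fin m → Bool) (p j : ℕ) : ℝ :=
  |blockDensity m A p (j / 2) - blockDensity m A (p + j / 2) (j / 2)|

/-- Adjusted imbalance: the imbalance if the block is live, `0` if it is dead. -/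
noncomputable def adjImbalance (c ε : ℝ) (m : ℕ) (A : Fin m → Bool) (p j : ℕ) : ℝ :=
  if IsLive c ε m A p j then imbalance m A p j else 0

/-- `Δ_j(A)`: the average adjusted imbalance over all `m` `j`-blocks. -/
noncomputable def DeltaAvg (c ε : ℝ) (m : ℕ) (A : Fin m → Bool) (j : ℕ) : ℝ :=
  (∑ p ∈ Finset.range m, adjImbalance c ε m A p j) / m

/-- `J = {2, 4, 8, …, 2^(⌊log₂ m⌋ - 2)}`. -/
def Jset (m : ℕ) : Finset ℕ := (Finset.Icc 1 (Nat.log 2 m - 2)).image (fun i => 2 ^ i)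

/-- The potential `φ` of a `j`-block: `0` if dead, `(μ - (1 - c·ε))²` if live,
where `μ` is its density. -/
noncomputable def potential (c ε : ℝ) (m : ℕ) (A : Fin m → Bool) (p j : ℕ) : ℝ :=
  if IsLive c ε m A p j then (blockDensity m A p j - (1 - c * ε)) ^ 2 else 0

/-- An array configuration on `m` slots with `k` elements: a boolean occupancy
vector with exactly `k` occupied slots. -/
abbrev Config (m k : ℕ) :=
  {A : Fin m → Bool // (Finset.univ.filter (fun i => A i = true)).card = k}

/-- Expectation of a real-valued function under a probability mass function on a
finite type. -/
noncomputable def pexp {α : Type*} [Fintype α] (p : PMF α) (f : α → ℝ) : ℝ :=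
  ∑ a, (p a).toReal * f a

/-- Probability of an event under a probability mass function on a finite type. -/
noncomputable def pprob {α : Type*} [Fintype α] (p : PMF α) (E : α → Prop) : ℝ :=
  pexp p (fun a => if E a then 1 else 0)

/-- `posOf A s` is the position (0-indexed slot) of the rank-`s` element of `A`,
i.e. the `s`-th smallest occupied slot (`s` is 1-indexed). -/
def posOf {m : ℕ} (A : Fin m → Bool) (s : ℕ) : ℕ :=
  (((List.range m).filter (fun i => cyc m A i))).getD (s - 1) 0

/-- A history-independent insertion/deletion model at size `n` on `m` slots:
distributions `C0` (on `n`-element configurations) and `C1` (on `(n+1)`-element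
configurations), insertion couplings `ins r` for each rank `r ∈ {1, …, n+1}`,
and a deletion coupling `del` for rank `n+1`, all with marginals `C0` and `C1`. -/
structure HIModel (m n : ℕ) where
  C0 : PMF (Config m n)
  C1 : PMF (Config m (n + 1))
  ins : ℕ → PMF (Config m n × Config m (n + 1))
  del : PMF (Config m n × Config m (n + 1))
  ins_fst : ∀ r, 1 ≤ r → r ≤ n + 1 → PMF.map Prod.fst (ins r) = C0
  ins_snd : ∀ r, 1 ≤ r → r ≤ n + 1 → PMF.map Prod.snd (ins r) = C1
  del_fst : PMF.map Prod.fst del = C0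
  del_snd : PMF.map Prod.snd del = C1

/-- The coupling `p` conditioned on its first coordinate being `A` (junk value
`p` itself when the conditioning event is null; such states are reached with
probability zero). -/
noncomputable def condFst {m n : ℕ} (p : PMF (Config m n × Config m (n + 1)))
    (A : Config m n) : PMF (Config m n × Config m (n + 1)) :=
  if h : ∃ q ∈ {q : Config m n × Config m (n + 1) | q.1 = A}, q ∈ p.support then
    p.filter {q | q.1 = A} h
  else p

/-- The coupling `p` conditioned on its second coordinate being `A'`. -/
noncomputable def condSnd {m n : ℕ} (p : PMF (Config m n × Config m (n + 1)))
    (A' : Config m (n + 1)) : PMF (Config m n × Config m (n + 1)) :=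
  if h : ∃ q ∈ {q : Config m n × Config m (n + 1) | q.2 = A'}, q ∈ p.support then
    p.filter {q | q.2 = A'} h
  else p

/-- Rank of an old element after an insertion at rank `r`. -/
def insShift (r s : ℕ) : ℕ := if s < r then s else s + 1

/-- The (cyclic) slots of the 1st, `(j/2)`-th and `j`-th positions of the
`j`-block starting at slot `p`: the slots of the boundary set `B(x)`. -/
def boundarySlots (m p j : ℕ) : Finset ℕ :=
  {p % m, (p + j / 2 - 1) % m, (p + j - 1) % m}

/-- An insertion at rank `r` realized by the pair `(A0, A1)` is critical to the
`j`-block of `A0` starting at slot `p`: the block is live in `A0` and some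
element of its boundary set is rearranged. -/
def InsCritical (c : ℝ) (m n r j p : ℕ) (A0 : Config m n) (A1 : Config m (n + 1)) : Prop :=
  IsLive c (1 - (n : ℝ) / m) m A0.1 p j ∧
  ∃ s ∈ Finset.Icc 1 n, posOf A0.1 s ∈ boundarySlots m p j ∧
    posOf A0.1 s ≠ posOf A1.1 (insShift r s)

/-- A deletion at rank `n+1` realized by the pair `(A0, A1)` (`A1` before, `A0`
after) is critical to the `j`-block of `A1` starting at slot `p`. -/
def DelCritical (c : ℝ) (m n j p : ℕ) (A0 : Config m n) (A1 : Config m (n + 1)) : Prop :=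
  IsLive c (1 - ((n : ℝ) + 1) / m) m A1.1 p j ∧
  ∃ s ∈ Finset.Icc 1 n, posOf A1.1 s ∈ boundarySlots m p j ∧
    posOf A1.1 s ≠ posOf A0.1 s

/-- Probability that, starting from configuration `A` and performing `k`
insertion/deletion pairs (insertion at rank `r`, deletion at rank `n+1`),
no operation is critical to the `j`-block starting at the position of the
current rank-`t` element (in the configuration just before that operation). -/
noncomputable def probNoCrit (c : ℝ) {m n : ℕ} (Mo : HIModel m n) (t r j : ℕ) :
    ℕ → Config m n → ℝ
  | 0, _ => 1
  | k + 1, A =>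
      pexp (condFst (Mo.ins r) A) fun q =>
        if InsCritical c m n r j (posOf q.1.1 t) q.1 q.2 then 0
        else pexp (condSnd Mo.del q.2) fun q' =>
          if DelCritical c m n j (posOf q'.2.1 t) q'.1 q'.2 then 0
          else probNoCrit c Mo t r j k q'.1

/-- `Δ_j` for the stationary distribution `C0` of a model. -/
noncomputable def DeltaExp (c : ℝ) {m n : ℕ} (Mo : HIModel m n) (j : ℕ) : ℝ :=
  pexp Mo.C0 (fun A => DeltaAvg c (1 - (n : ℝ) / m) m A.1 j)

/-- Cost of an insertion at rank `r` realized by the pair `(A0, A1)`: one plus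
the number of rearranged elements. -/
noncomputable def insCost (m n r : ℕ) (A0 : Config m n) (A1 : Config m (n + 1)) : ℕ :=
  1 + ((Finset.Icc 1 n).filter
        (fun s => posOf A0.1 s ≠ posOf A1.1 (insShift r s))).card

/-- Cost of a deletion at rank `n+1` realized by the pair `(A0, A1)` (`A1`
before, `A0` after): one plus the number of rearranged elements. -/
noncomputable def delCost (m n : ℕ) (A0 : Config m n) (A1 : Config m (n + 1)) : ℕ :=
  1 + ((Finset.Icc 1 n).filter (fun s => posOf A1.1 s ≠ posOf A0.1 s)).card

/-- Expected total cost of an insertion at rank `r` (starting from `A ∼ C0`)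
followed by a deletion at rank `n+1`. -/
noncomputable def expPairCost {m n : ℕ} (Mo : HIModel m n) (r : ℕ) : ℝ :=
  pexp Mo.C0 (fun A =>
    pexp (condFst (Mo.ins r) A) (fun q =>
      (insCost m n r q.1 q.2 : ℝ) +
        pexp (condSnd Mo.del q.2) (fun q' => (delCost m n q'.1 q'.2 : ℝ))))

noncomputable def GG (m : ℕ) (A : Fin m → Bool) (a : ℕ) : ℕ :=
  Nat.count (fun i => cyc m A i = true) (a + 1)

theorem getD_filter_range (P : ℕ → Bool) (m a : ℕ) (ha : a < m) (hP : P a = true) :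
    ((List.range m).filter P).getD (Nat.count (fun i => P i = true) a) 0 = a := by
  obtain ⟨b, rfl⟩ : ∃ b, m = a + (b + 1) := ⟨m - a - 1, by omega⟩
  have hl : ((List.range a).filter P).length = Nat.count (fun i => P i = true) a := by
    simp [Nat.count, List.countP_eq_length_filter]
  rw [List.range_add, List.filter_append, List.getD_append_right _ _ _ _ (by omega), hl]
  simp [List.range_succ_eq_map, hP]

theorem posOf_GG {m : ℕ} (A : Fin m → Bool) (a : ℕ) (ha : a < m) (h : cyc m A a = true) :
    posOf A (GG m A a) = a := by
  unfold posOf GG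
  rw [Nat.count_succ, if_pos h, Nat.add_sub_cancel]
  exact getD_filter_range (fun i => cyc m A i) m a ha h

theorem count_config {m k : ℕ} (A : Config m k) :
    Nat.count (fun i => cyc m A.1 i = true) m = k := by
  rw [Nat.count_eq_card_filter_range]
  refine Eq.trans ?_ A.2
  symm
  apply Finset.card_bij (fun i _ => i.1)
  · intro i hi
    have := i.2
    simp only [Finset.mem_filter, Finset.mem_univ, true_and, Finset.mem_range] at hi ⊢
    refine ⟨i.2, ?_⟩
    unfold cyc
    rw [dif_pos (by omega)]
    simp only [Nat.mod_eq_of_lt i.2]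
    exact hi
  · intro i _ j _ h
    exact Fin.ext h
  · intro b hb
    simp only [Finset.mem_filter, Finset.mem_range] at hb
    refine ⟨⟨b, hb.1⟩, ?_, rfl⟩
    have h2 := hb.2
    unfold cyc at h2
    rw [dif_pos (by omega)] at h2
    simp only [Nat.mod_eq_of_lt hb.1] at h2
    simpa using h2

theorem exists_count (P : ℕ → Prop) [DecidablePred P] (s : ℕ) (hs : 1 ≤ s) :
    ∀ m, s ≤ Nat.count P m → ∃ a, a < m ∧ P a ∧ Nat.count P (a + 1) = s := by
  intro m
  induction m with
  | zero => intro h; simp at h; omega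
  | succ m ih =>
    intro h
    by_cases h1 : s ≤ Nat.count P m
    · obtain ⟨a, h2, h3⟩ := ih h1
      exact ⟨a, by omega, h3⟩
    · have h0 := h
      rw [Nat.count_succ] at h
      by_cases hp : P m
      · rw [if_pos hp] at h
        refine ⟨m, by omega, hp, ?_⟩
        rw [Nat.count_succ, if_pos hp]; omega
      · rw [if_neg hp] at h; omega

theorem GG_posOf {m k : ℕ} (A : Config m k) (s a : ℕ) (h1 : 1 ≤ s) (h2 : s ≤ k)
    (hp : posOf A.1 s = a) : cyc m A.1 a = true ∧ GG m A.1 a = s := by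
  obtain ⟨b, hb, hP, hc⟩ := exists_count (fun i => cyc m A.1 i = true) s h1 m
    (by rw [count_config A]; exact h2)
  have := posOf_GG A.1 b hb hP
  unfold GG at this
  rw [hc, hp] at this
  subst this
  exact ⟨hP, hc⟩

theorem GG_mono {m : ℕ} (A : Fin m → Bool) {a b : ℕ} (h : a ≤ b) : GG m A a ≤ GG m A b :=
  Nat.count_monotone _ (by omega)

theorem GG_le {m : ℕ} (A : Fin m → Bool) (a : ℕ) : GG m A a ≤ a + 1 := Nat.count_le _

theorem GG_add_block {m : ℕ} (A : Fin m → Bool) (a k : ℕ) :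
    GG m A (a + k) = GG m A a + blockCount m A (a + 1) k := by
  unfold GG blockCount
  rw [show a + k + 1 = (a + 1) + k by ring, Nat.count_add, Nat.count_eq_card_filter_range _ k]

theorem blockCount_le {m : ℕ} (A : Fin m → Bool) (a k : ℕ) : blockCount m A a k ≤ k := by
  unfold blockCount
  exact (Finset.card_filter_le _ _).trans (by simp)

theorem GG_pos {m : ℕ} (A : Fin m → Bool) (a : ℕ) (h : cyc m A a = true) : 1 ≤ GG m A a := by
  unfold GG
  rw [Nat.count_succ, if_pos h]; omega

def Good (m : ℕ) (A : Fin m → Bool) (r a h : ℕ) : Prop :=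
  cyc m A a = true ∧ cyc m A (a + h) = true ∧ cyc m A (a + 2 * h) = true ∧
  h + 4 * GG m A a ≤ 4 * r ∧ 2 * r ≤ h + 1 + 2 * GG m A a ∧ h + 8 * r ≤ 8 * GG m A (a + h) + 8

noncomputable def dd (m : ℕ) (A : Fin m → Bool) (a h : ℕ) : ℝ :=
  2 * (GG m A (a + h) : ℝ) - GG m A a - GG m A (a + 2 * h)

noncomputable def ff (m : ℕ) (A : Fin m → Bool) (r a h : ℕ) (L : ℝ) : ℝ :=
  if Good m A r a h then max 0 (min (2 * L + 1) (dd m A a h + L)) else 0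

def Charged (m : ℕ) (A : Fin m → Bool) (r a h : ℕ) (S : Finset ℕ) : Prop :=
  Good m A r a h ∧ (GG m A a ∈ S ∨ GG m A (a + h) ∈ S ∨ GG m A (a + 2 * h) ∈ S)

noncomputable def insMoved (m n r : ℕ) (A0 : Config m n) (A1 : Config m (n + 1)) : Finset ℕ :=
  (Finset.Icc 1 n).filter (fun s => posOf A0.1 s ≠ posOf A1.1 (insShift r s))

noncomputable def delMoved (m n : ℕ) (A0 : Config m n) (A1 : Config m (n + 1)) : Finset ℕ :=
  (Finset.Icc 1 n).filter (fun s => posOf A1.1 s ≠ posOf A0.1 s)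

noncomputable def ind (P : Prop) : ℝ := if P then 1 else 0

theorem ind_nonneg (P : Prop) : 0 ≤ ind P := by unfold ind; split_ifs <;> norm_num
theorem ind_le_one (P : Prop) : ind P ≤ 1 := by unfold ind; split_ifs <;> norm_num
theorem ind_pos {P : Prop} (h : P) : ind P = 1 := by simp [ind, h]
theorem ind_neg {P : Prop} (h : ¬ P) : ind P = 0 := by simp [ind, h]

theorem ff_nonneg (m : ℕ) (A : Fin m → Bool) (r a h : ℕ) (L : ℝ) : 0 ≤ ff m A r a h L := by
  unfold ff; split_ifs
  · exact le_max_left _ _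
  · exact le_rfl

theorem ff_le (m : ℕ) (A : Fin m → Bool) (r a h : ℕ) (L : ℝ) (hL : 0 ≤ L) :
    ff m A r a h L ≤ 2 * L + 1 := by
  unfold ff; split_ifs
  · exact max_le (by linarith) (min_le_left _ _)
  · linarith

theorem ins_keep {m n r : ℕ} (A0 : Config m n) (A1 : Config m (n + 1)) (x : ℕ) (hx : x < m)
    (hc : cyc m A0.1 x = true) (hn : GG m A0.1 x ≤ n) (hS : GG m A0.1 x ∉ insMoved m n r A0 A1) :
    cyc m A1.1 x = true ∧ GG m A1.1 x = insShift r (GG m A0.1 x) := by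
  have h1 := GG_pos A0.1 x hc
  have h2 := posOf_GG A0.1 x hx hc
  apply GG_posOf A1
  · unfold insShift; split_ifs <;> omega
  · unfold insShift; split_ifs <;> omega
  · unfold insMoved at hS
    simp only [Finset.mem_filter, Finset.mem_Icc, not_and, not_not] at hS
    rw [← hS ⟨h1, hn⟩, h2]

theorem del_keep {m n : ℕ} (A0 : Config m n) (A1 : Config m (n + 1)) (x : ℕ) (hx : x < m)
    (hc : cyc m A1.1 x = true) (hn : GG m A1.1 x ≤ n) (hS : GG m A1.1 x ∉ delMoved m n A0 A1) :
    cyc m A0.1 x = true ∧ GG m A0.1 x = GG m A1.1 x := by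
  have h1 := GG_pos A1.1 x hc
  have h2 := posOf_GG A1.1 x hx hc
  apply GG_posOf A0 _ _ h1 hn
  unfold delMoved at hS
  simp only [Finset.mem_filter, Finset.mem_Icc, not_and, not_not] at hS
  rw [← hS ⟨h1, hn⟩, h2]

theorem ins_step {m n r a h : ℕ} (hh : 1 ≤ h) (hm : a + 2 * h < m) (hn : a + 2 * h + 1 ≤ n)
    (A0 : Config m n) (A1 : Config m (n + 1)) (L : ℝ) (hL : 0 ≤ L) :
    ff m A0.1 r a h L + ind (Good m A0.1 r a h ∧ |dd m A0.1 a h| < L) ≤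
      ff m A1.1 r a h L + (2 * L + 2) * ind (Charged m A0.1 r a h (insMoved m n r A0 A1)) := by
  have hf0 := ff_nonneg m A1.1 r a h L
  have hf1 := ff_le m A0.1 r a h L hL
  by_cases hg : Good m A0.1 r a h
  · by_cases hc : Charged m A0.1 r a h (insMoved m n r A0 A1)
    · rw [ind_pos hc]
      have := ind_le_one (Good m A0.1 r a h ∧ |dd m A0.1 a h| < L)
      linarith
    · rw [ind_neg hc]
      have hc' : ¬ (_ ∨ _ ∨ _) := fun h => hc ⟨hg, h⟩
      push Not at hc'
      obtain ⟨s1, s2, s3⟩ := hc'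
      have hg' := hg
      obtain ⟨c1, c2, c3, e1, e2, e3⟩ := hg
      have l1 := GG_le A0.1 a
      have l2 := GG_le A0.1 (a + h)
      have l3 := GG_le A0.1 (a + 2 * h)
      have mo : GG m A0.1 (a + h) ≤ GG m A0.1 (a + 2 * h) := GG_mono _ (by omega)
      obtain ⟨k1, g1⟩ := ins_keep A0 A1 a (by omega) c1 (by omega) s1
      obtain ⟨k2, g2⟩ := ins_keep A0 A1 (a + h) (by omega) c2 (by omega) s2
      obtain ⟨k3, g3⟩ := ins_keep A0 A1 (a + 2 * h) (by omega) c3 (by omega) s3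
      unfold insShift at g1 g2 g3
      rw [if_pos (by omega)] at g1
      rw [if_neg (by omega)] at g2
      rw [if_neg (by omega)] at g3
      have gd : Good m A1.1 r a h := ⟨k1, k2, k3, by omega, by omega, by omega⟩
      have hd : dd m A1.1 a h = dd m A0.1 a h + 1 := by
        unfold dd; rw [g1, g2, g3]; push_cast; ring
      unfold ff
      rw [if_pos hg', if_pos gd, hd]
      by_cases hl : |dd m A0.1 a h| < L
      · rw [ind_pos ⟨hg', hl⟩]
        rw [abs_lt] at hl
        rw [min_eq_right (by linarith), min_eq_right (by linarith), max_eq_right (by linarith),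
          max_eq_right (by linarith)]
        linarith
      · rw [ind_neg (fun h => hl h.2)]
        have : max 0 (min (2 * L + 1) (dd m A0.1 a h + L)) ≤
            max 0 (min (2 * L + 1) (dd m A0.1 a h + 1 + L)) :=
          max_le_max le_rfl (min_le_min le_rfl (by linarith))
        linarith
  · rw [ind_neg (fun h => hg h.1)]
    have : ff m A0.1 r a h L = 0 := by unfold ff; rw [if_neg hg]
    have := ind_nonneg (Charged m A0.1 r a h (insMoved m n r A0 A1))
    nlinarith

theorem del_step {m n r a h : ℕ} (hm : a + 2 * h < m) (hn : a + 2 * h + 1 ≤ n)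
    (A0 : Config m n) (A1 : Config m (n + 1)) (L : ℝ) (hL : 0 ≤ L) :
    ff m A1.1 r a h L ≤
      ff m A0.1 r a h L + (2 * L + 2) * ind (Charged m A1.1 r a h (delMoved m n A0 A1)) := by
  have hf0 := ff_nonneg m A0.1 r a h L
  have hf1 := ff_le m A1.1 r a h L hL
  by_cases hg : Good m A1.1 r a h
  · by_cases hc : Charged m A1.1 r a h (delMoved m n A0 A1)
    · rw [ind_pos hc]
      linarith
    · rw [ind_neg hc]
      have hc' : ¬ (_ ∨ _ ∨ _) := fun h => hc ⟨hg, h⟩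
      push Not at hc'
      obtain ⟨s1, s2, s3⟩ := hc'
      have hg' := hg
      obtain ⟨c1, c2, c3, e1, e2, e3⟩ := hg
      have l1 := GG_le A1.1 a
      have l2 := GG_le A1.1 (a + h)
      have l3 := GG_le A1.1 (a + 2 * h)
      obtain ⟨k1, g1⟩ := del_keep A0 A1 a (by omega) c1 (by omega) s1
      obtain ⟨k2, g2⟩ := del_keep A0 A1 (a + h) (by omega) c2 (by omega) s2
      obtain ⟨k3, g3⟩ := del_keep A0 A1 (a + 2 * h) (by omega) c3 (by omega) s3
      have gd : Good m A0.1 r a h := ⟨k1, k2, k3, by omega, by omega, by omega⟩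
      have hd : dd m A0.1 a h = dd m A1.1 a h := by
        unfold dd; rw [g1, g2, g3]
      unfold ff
      rw [if_pos hg', if_pos gd, hd]
      linarith
  · have : ff m A1.1 r a h L = 0 := by unfold ff; rw [if_neg hg]
    have := ind_nonneg (Charged m A1.1 r a h (delMoved m n A0 A1))
    nlinarith

def ww (r s : ℕ) : ℕ := if s < r then r - s else s + 1 - r

theorem bucket_card (K w : ℕ) (hw : 1 ≤ w) :
    ((Finset.range K).filter (fun i => 2 ^ i ≤ 8 * w ∧ w ≤ 2 * 2 ^ i)).card ≤ 5 := by
  have : ((Finset.range K).filter (fun i => 2 ^ i ≤ 8 * w ∧ w ≤ 2 * 2 ^ i)) ⊆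
      Finset.Icc (Nat.log 2 w - 1) (Nat.log 2 w + 3) := by
    intro i hi
    simp only [Finset.mem_filter, Finset.mem_range, Finset.mem_Icc] at hi ⊢
    obtain ⟨_, h1, h2⟩ := hi
    have h3 : 2 ^ Nat.log 2 w ≤ w := Nat.pow_log_le_self 2 (by omega)
    have h4 : w < 2 ^ (Nat.log 2 w + 1) := Nat.lt_pow_succ_log_self (by norm_num) w
    constructor
    · have : 2 ^ Nat.log 2 w ≤ 2 ^ (i + 1) := by rw [pow_succ 2 i]; omega
      have := (Nat.pow_le_pow_iff_right (by norm_num : 1 < 2)).1 this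
      omega
    · have : 2 ^ i < 2 ^ (Nat.log 2 w + 1 + 3) := by rw [pow_add _ _ 3]; omega
      have := (Nat.pow_lt_pow_iff_right (by norm_num : 1 < 2)).1 this
      omega
  refine (Finset.card_le_card this).trans ?_
  simp only [Nat.card_Icc]; omega

theorem charge_one {m N h e : ℕ} (A : Fin m → Bool) (r : ℕ) (S : Finset ℕ)
    (hm : ∀ a < N, a + e < m)
    (hocc : ∀ a, Good m A r a h → cyc m A (a + e) = true)
    (hb : ∀ a, Good m A r a h → h ≤ 8 * ww r (GG m A (a + e)) ∧ ww r (GG m A (a + e)) ≤ 2 * h) :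
    ∑ a ∈ Finset.range N, ind (Good m A r a h ∧ GG m A (a + e) ∈ S) ≤
      ((S.filter (fun s => h ≤ 8 * ww r s ∧ ww r s ≤ 2 * h)).card : ℝ) := by
  have hcd : ∑ a ∈ Finset.range N, ind (Good m A r a h ∧ GG m A (a + e) ∈ S) =
      (((Finset.range N).filter (fun a => Good m A r a h ∧ GG m A (a + e) ∈ S)).card : ℝ) := by
    rw [Finset.card_filter]; push_cast
    exact Finset.sum_congr rfl fun a _ => by unfold ind; congr
  rw [hcd]
  norm_cast
  apply Finset.card_le_card_of_injOn (fun a => GG m A (a + e))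
  · intro a ha
    simp only [Finset.coe_filter, Set.mem_ofPred_eq, Finset.mem_range] at ha ⊢
    exact ⟨ha.2.2, hb a ha.2.1⟩
  · intro a ha b hb' hab
    simp only [Finset.coe_filter, Set.mem_ofPred_eq, Finset.mem_range] at ha hb' hab
    have h1 := posOf_GG A (a + e) (hm a ha.1) (hocc a ha.2.1)
    have h2 := posOf_GG A (b + e) (hm b hb'.1) (hocc b hb'.2.1)
    rw [hab] at h1
    omega

theorem charge_h {m N h : ℕ} (A : Fin m → Bool) (r : ℕ) (S : Finset ℕ) (hh : 1 ≤ h)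
    (hm : ∀ a < N, a + 2 * h < m) :
    ∑ a ∈ Finset.range N, ind (Charged m A r a h S) ≤
      3 * ((S.filter (fun s => h ≤ 8 * ww r s ∧ ww r s ≤ 2 * h)).card : ℝ) := by
  have p1 := charge_one (N := N) (h := h) (e := 0) A r S (fun a ha => by have := hm a ha; omega)
    (fun a hg => hg.1) (fun a hg => by
      obtain ⟨c1, c2, c3, e1, e2, e3⟩ := hg
      unfold ww
      simp only [Nat.add_zero]
      rw [if_pos (by omega)]; omega)
  have p2 := charge_one (N := N) (h := h) (e := h) A r S (fun a ha => by have := hm a ha; omega)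
    (fun a hg => hg.2.1) (fun a hg => by
      obtain ⟨c1, c2, c3, e1, e2, e3⟩ := hg
      have := GG_add_block A a h
      have := blockCount_le A (a + 1) h
      unfold ww
      rw [if_neg (by omega)]; omega)
  have p3 := charge_one (N := N) (h := h) (e := 2 * h) A r S (fun a ha => by have := hm a ha; omega)
    (fun a hg => hg.2.2.1) (fun a hg => by
      obtain ⟨c1, c2, c3, e1, e2, e3⟩ := hg
      have := GG_add_block A a (2 * h)
      have := blockCount_le A (a + 1) (2 * h)
      have mo : GG m A (a + h) ≤ GG m A (a + 2 * h) := GG_mono _ (by omega)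
      unfold ww
      rw [if_neg (by omega)]; omega)
  have : ∑ a ∈ Finset.range N, ind (Charged m A r a h S) ≤
      ∑ a ∈ Finset.range N, (ind (Good m A r a h ∧ GG m A (a + 0) ∈ S) +
        ind (Good m A r a h ∧ GG m A (a + h) ∈ S) +
        ind (Good m A r a h ∧ GG m A (a + 2 * h) ∈ S)) := by
    apply Finset.sum_le_sum
    intro a _
    have n1 := ind_nonneg (Good m A r a h ∧ GG m A (a + 0) ∈ S)
    have n2 := ind_nonneg (Good m A r a h ∧ GG m A (a + h) ∈ S)
    have n3 := ind_nonneg (Good m A r a h ∧ GG m A (a + 2 * h) ∈ S)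
    by_cases hc : Charged m A r a h S
    · rw [ind_pos hc]
      obtain ⟨hg, h1 | h1 | h1⟩ := hc
      · rw [ind_pos (P := Good m A r a h ∧ GG m A (a + 0) ∈ S) ⟨hg, h1⟩]; linarith
      · rw [ind_pos (P := Good m A r a h ∧ GG m A (a + h) ∈ S) ⟨hg, h1⟩]; linarith
      · rw [ind_pos (P := Good m A r a h ∧ GG m A (a + 2 * h) ∈ S) ⟨hg, h1⟩]; linarith
    · rw [ind_neg hc]; linarith
  rw [Finset.sum_add_distrib, Finset.sum_add_distrib] at this
  linarith

theorem charge_all {m N K : ℕ} (A : Fin m → Bool) (r : ℕ) (S : Finset ℕ)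
    (hm : ∀ i < K, ∀ a < N, a + 2 * 2 ^ i < m) :
    ∑ i ∈ Finset.range K, ∑ a ∈ Finset.range N, ind (Charged m A r a (2 ^ i) S) ≤
      15 * (S.card : ℝ) := by
  have h1 : ∑ i ∈ Finset.range K, ∑ a ∈ Finset.range N, ind (Charged m A r a (2 ^ i) S) ≤
      ∑ i ∈ Finset.range K,
        3 * ((S.filter (fun s => 2 ^ i ≤ 8 * ww r s ∧ ww r s ≤ 2 * 2 ^ i)).card : ℝ) := by
    apply Finset.sum_le_sum
    intro i hi
    exact charge_h A r S Nat.one_le_two_pow (hm i (Finset.mem_range.1 hi))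
  have h2 : ∑ i ∈ Finset.range K,
      (S.filter (fun s => 2 ^ i ≤ 8 * ww r s ∧ ww r s ≤ 2 * 2 ^ i)).card ≤ 5 * S.card := by
    have e := Finset.sum_card_bipartiteAbove_eq_sum_card_bipartiteBelow
      (s := Finset.range K) (t := S) (fun i s => 2 ^ i ≤ 8 * ww r s ∧ ww r s ≤ 2 * 2 ^ i)
    unfold Finset.bipartiteAbove Finset.bipartiteBelow at e
    rw [e]
    rw [mul_comm]
    apply Finset.sum_le_card_nsmul
    intro s _
    apply bucket_card
    unfold ww; split_ifs <;> omega
  have h3 : (∑ i ∈ Finset.range K,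
      ((S.filter (fun s => 2 ^ i ≤ 8 * ww r s ∧ ww r s ≤ 2 * 2 ^ i)).card : ℝ)) ≤ 5 * S.card := by
    exact_mod_cast h2
  rw [← Finset.mul_sum] at h1
  linarith

theorem pexp_mono {α : Type*} [Fintype α] (p : PMF α) {f g : α → ℝ} (h : ∀ a, f a ≤ g a) :
    pexp p f ≤ pexp p g :=
  Finset.sum_le_sum fun a _ => mul_le_mul_of_nonneg_left (h a) ENNReal.toReal_nonneg

theorem pexp_add {α : Type*} [Fintype α] (p : PMF α) (f g : α → ℝ) :
    pexp p (fun a => f a + g a) = pexp p f + pexp p g := by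
  simp [pexp, mul_add, Finset.sum_add_distrib]

theorem pexp_mul {α : Type*} [Fintype α] (p : PMF α) (k : ℝ) (f : α → ℝ) :
    pexp p (fun a => k * f a) = k * pexp p f := by
  simp only [pexp, Finset.mul_sum]
  exact Finset.sum_congr rfl fun a _ => by ring

theorem pexp_sum {α ι : Type*} [Fintype α] (p : PMF α) (s : Finset ι) (f : ι → α → ℝ) :
    pexp p (fun a => ∑ i ∈ s, f i a) = ∑ i ∈ s, pexp p (f i) := by
  simp only [pexp, Finset.mul_sum]
  exact Finset.sum_comm

theorem pexp_const {α : Type*} [Fintype α] (p : PMF α) (k : ℝ) : pexp p (fun _ => k) = k := by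
  simp only [pexp]
  rw [← Finset.sum_mul, ← ENNReal.toReal_sum (fun a _ => p.apply_ne_top a), ← tsum_fintype (L := .unconditional α),
    p.tsum_coe]
  simp

theorem map_toReal {α β : Type*} [Fintype α] (p : PMF α) (f : α → β) (b : β) :
    ((PMF.map f p) b).toReal = ∑ a, if b = f a then (p a).toReal else 0 := by
  rw [PMF.map_apply, tsum_fintype, ENNReal.toReal_sum]
  · exact Finset.sum_congr rfl fun a _ => by split_ifs <;> simp
  · intro a _; split_ifs
    · exact p.apply_ne_top a
    · simp

theorem pexp_map {α β : Type*} [Fintype α] [Fintype β] (p : PMF α) (f : α → β) (g : β → ℝ) :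
    pexp (PMF.map f p) g = pexp p (fun a => g (f a)) := by
  simp only [pexp, map_toReal, Finset.sum_mul]
  rw [Finset.sum_comm]
  refine Finset.sum_congr rfl fun a _ => ?_
  simp [ite_mul]

theorem pexp_cond {α β : Type*} [Fintype α] [Fintype β] (p : PMF α) (f : α → β) (c : β → PMF α)
    (hc : ∀ b, ∀ h : ∃ q ∈ {q : α | f q = b}, q ∈ p.support, c b = p.filter {q | f q = b} h) (F : α → ℝ) :
    pexp (PMF.map f p) (fun b => pexp (c b) F) = pexp p F := by
  have key : ∀ b q, ((PMF.map f p) b).toReal * ((c b) q).toReal =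
      if f q = b then (p q).toReal else 0 := by
    intro b q
    by_cases h : ∃ q ∈ {q : α | f q = b}, q ∈ p.support
    · rw [hc b h]
      split_ifs with hq
      swap
      · rw [PMF.filter_apply, Set.indicator_of_notMem (by exact hq)]; simp
      rw [PMF.filter_apply, ← ENNReal.toReal_mul, PMF.map_apply]
      have e : (∑' a', ({q | f q = b} : Set α).indicator p a') = ∑' a, if b = f a then p a else 0 := by
        apply tsum_congr; intro a
        simp [Set.indicator_apply, eq_comm]
      rw [e, Set.indicator_of_mem (by exact hq)]
      congr 1
      have h0 : (∑' a, if b = f a then p a else 0) ≠ 0 := by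
        rw [← PMF.map_apply]
        obtain ⟨q', h1, h2⟩ := h
        rw [← PMF.mem_support_iff]
        rw [PMF.mem_support_map_iff]
        exact ⟨q', h2, h1⟩
      have h1 : (∑' a, if b = f a then p a else 0) ≠ ⊤ := by
        rw [← PMF.map_apply]; exact PMF.apply_ne_top _ _
      rw [mul_comm (p q), ← mul_assoc, ENNReal.mul_inv_cancel h0 h1, one_mul]
    · have hz : (PMF.map f p) b = 0 := by
        by_contra hne
        obtain ⟨q', h1, h2⟩ := (PMF.mem_support_map_iff _ _ _).1 ((PMF.mem_support_iff _ _).2 hne)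
        exact h ⟨q', h2, h1⟩
      have hz' : f q = b → p q = 0 := fun hq => by
        by_contra hne
        exact h ⟨q, hq, (PMF.mem_support_iff _ _).2 hne⟩
      split_ifs with hq
      · simp [hz, hz' hq]
      · simp [hz]
  simp only [pexp, Finset.mul_sum]
  rw [Finset.sum_comm]
  refine Finset.sum_congr rfl fun q _ => ?_
  simp only [← mul_assoc, key, ite_mul, zero_mul]
  simp

theorem expPairCost_eq {m n : ℕ} (Mo : HIModel m n) (r : ℕ) (h1 : 1 ≤ r) (h2 : r ≤ n + 1) :
    expPairCost Mo r = pexp (Mo.ins r) (fun q => (insCost m n r q.1 q.2 : ℝ)) +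
      pexp Mo.del (fun q => (delCost m n q.1 q.2 : ℝ)) := by
  unfold expPairCost
  have e1 := pexp_cond (Mo.ins r) Prod.fst (condFst (Mo.ins r)) (fun b h => dif_pos h)
    (fun q => (insCost m n r q.1 q.2 : ℝ) +
        pexp (condSnd Mo.del q.2) (fun q' => (delCost m n q'.1 q'.2 : ℝ)))
  rw [Mo.ins_fst r h1 h2] at e1
  rw [e1, pexp_add]
  congr 1
  have e2 := pexp_map (Mo.ins r) Prod.snd
    (fun A' => pexp (condSnd Mo.del A') (fun q' => (delCost m n q'.1 q'.2 : ℝ)))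
  rw [Mo.ins_snd r h1 h2, ← Mo.del_snd] at e2
  rw [← e2]
  exact pexp_cond Mo.del Prod.snd (condSnd Mo.del) (fun b h => dif_pos h) _

theorem one_pair {m n : ℕ} (Mo : HIModel m n) (r a h : ℕ) (h1 : 1 ≤ r) (h2 : r ≤ n + 1)
    (hh : 1 ≤ h) (hm : a + 2 * h < m) (hn : a + 2 * h + 1 ≤ n) (L : ℝ) (hL : 0 ≤ L) :
    pexp Mo.C0 (fun A => ind (Good m A.1 r a h ∧ |dd m A.1 a h| < L)) ≤
      (2 * L + 2) * (pexp (Mo.ins r) (fun q =>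
          ind (Charged m q.1.1 r a h (insMoved m n r q.1 q.2))) +
        pexp Mo.del (fun q => ind (Charged m q.2.1 r a h (delMoved m n q.1 q.2)))) := by
  have i1 := pexp_mono (Mo.ins r) (fun q => ins_step (r := r) hh hm hn q.1 q.2 L hL)
  have i2 := pexp_mono Mo.del (fun q => del_step (r := r) hm hn q.1 q.2 L hL)
  rw [pexp_add, pexp_add, pexp_mul] at i1
  rw [pexp_add, pexp_mul] at i2
  rw [← pexp_map (Mo.ins r) Prod.fst (fun A => ff m A.1 r a h L),
    ← pexp_map (Mo.ins r) Prod.fst (fun A => ind (Good m A.1 r a h ∧ |dd m A.1 a h| < L)),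
    ← pexp_map (Mo.ins r) Prod.snd (fun A => ff m A.1 r a h L),
    Mo.ins_fst r h1 h2, Mo.ins_snd r h1 h2] at i1
  rw [← pexp_map Mo.del Prod.fst (fun A => ff m A.1 r a h L),
    ← pexp_map Mo.del Prod.snd (fun A => ff m A.1 r a h L),
    Mo.del_fst, Mo.del_snd] at i2
  linarith

theorem cost_bound {m n N K : ℕ} (Mo : HIModel m n) (r : ℕ) (h1 : 1 ≤ r) (h2 : r ≤ n + 1)
    (hm : ∀ i < K, ∀ a < N, a + 2 * 2 ^ i < m) (hn : ∀ i < K, ∀ a < N, a + 2 * 2 ^ i + 1 ≤ n)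
    (L : ℕ → ℝ) (hL : ∀ i, 0 ≤ L i) :
    ∑ i ∈ Finset.range K, ∑ a ∈ Finset.range N, (1 / (2 * L i + 2)) *
      pexp Mo.C0 (fun A => ind (Good m A.1 r a (2 ^ i) ∧ |dd m A.1 a (2 ^ i)| < L i)) ≤
      15 * expPairCost Mo r := by
  have s1 : ∑ i ∈ Finset.range K, ∑ a ∈ Finset.range N, (1 / (2 * L i + 2)) *
      pexp Mo.C0 (fun A => ind (Good m A.1 r a (2 ^ i) ∧ |dd m A.1 a (2 ^ i)| < L i)) ≤
      ∑ i ∈ Finset.range K, ∑ a ∈ Finset.range N, (pexp (Mo.ins r) (fun q =>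
          ind (Charged m q.1.1 r a (2 ^ i) (insMoved m n r q.1 q.2))) +
        pexp Mo.del (fun q => ind (Charged m q.2.1 r a (2 ^ i) (delMoved m n q.1 q.2)))) := by
    apply Finset.sum_le_sum; intro i hi
    apply Finset.sum_le_sum; intro a ha
    rw [Finset.mem_range] at hi ha
    have := one_pair Mo r a (2 ^ i) h1 h2 Nat.one_le_two_pow (hm i hi a ha) (hn i hi a ha) (L i) (hL i)
    have hp : 0 < 2 * L i + 2 := by have := hL i; linarith
    rw [one_div, inv_mul_le_iff₀ hp]
    exact this
  refine s1.trans ?_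
  simp only [Finset.sum_add_distrib, ← pexp_sum]
  rw [expPairCost_eq Mo r h1 h2, mul_add, ← pexp_mul, ← pexp_mul]
  apply add_le_add
  · apply pexp_mono; intro q
    refine (charge_all q.1.1 r _ hm).trans ?_
    unfold insCost insMoved
    push_cast; linarith
  · apply pexp_mono; intro q
    refine (charge_all q.2.1 r _ hm).trans ?_
    unfold delCost delMoved
    push_cast; linarith

noncomputable def hole (m : ℕ) (A : Fin m → Bool) (x : ℕ) : ℝ := ind (¬ cyc m A x = true)

theorem hole_nonneg (m : ℕ) (A : Fin m → Bool) (x : ℕ) : 0 ≤ hole m A x := ind_nonneg _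

theorem sum_hole_block (m : ℕ) (A : Fin m → Bool) (p k : ℕ) :
    (k : ℝ) - blockCount m A p k = ∑ t ∈ Finset.range k, hole m A (p + t) := by
  unfold blockCount hole ind
  rw [Finset.card_filter]
  push_cast
  have : (k : ℝ) = ∑ t ∈ Finset.range k, (1 : ℝ) := by simp
  rw [this, ← Finset.sum_sub_distrib]
  refine Finset.sum_congr rfl fun t _ => ?_
  by_cases h : cyc m A (p + t) = true <;> simp [h]

theorem sum_hole {m n : ℕ} (A : Config m n) :
    ∑ x ∈ Finset.range m, hole m A.1 x = (m : ℝ) - n := by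
  have h := sum_hole_block m A.1 0 m
  have : blockCount m A.1 0 m = n := by
    have := count_config A
    rw [Nat.count_eq_card_filter_range] at this
    unfold blockCount
    simpa using this
  rw [this] at h
  rw [h]
  simp

theorem sum_shift_le (g : ℕ → ℝ) (hg : ∀ x, 0 ≤ g x) (N e m : ℕ) (h : N + e ≤ m) :
    ∑ a ∈ Finset.range N, g (a + e) ≤ ∑ x ∈ Finset.range m, g x := by
  rw [Finset.range_eq_Ico, Finset.sum_Ico_add' g 0 N e]
  apply Finset.sum_le_sum_of_subset_of_nonneg
  · intro x hx
    simp only [Finset.mem_Ico, Finset.mem_range] at hx ⊢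
    omega
  · intro x _ _; exact hg x

theorem sum_block_holes {m n : ℕ} (A : Config m n) (N k : ℕ) (h : N + k ≤ m) :
    ∑ a ∈ Finset.range N, ((k : ℝ) - blockCount m A.1 (a + 1) k) ≤ k * ((m : ℝ) - n) := by
  simp only [sum_hole_block]
  rw [Finset.sum_comm]
  have : ∀ t ∈ Finset.range k, ∑ a ∈ Finset.range N, hole m A.1 (a + 1 + t) ≤ (m : ℝ) - n := by
    intro t ht
    rw [Finset.mem_range] at ht
    rw [← sum_hole A]
    have := sum_shift_le (hole m A.1) (hole_nonneg _ _) N (1 + t) m (by omega)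
    simpa only [add_assoc] using this
  refine (Finset.sum_le_sum this).trans ?_
  rw [Finset.sum_const, Finset.card_range, nsmul_eq_mul]

def QQ (m : ℕ) (A : Fin m → Bool) (a h : ℕ) : Prop :=
  cyc m A a = true ∧ cyc m A (a + h) = true ∧ cyc m A (a + 2 * h) = true ∧
  5 * h ≤ 8 * blockCount m A (a + 1) h

theorem imb_eq {m : ℕ} (A : Fin m → Bool) (a h : ℕ) (hh : 1 ≤ h) :
    (h : ℝ) * imbalance m A (a + 1) (2 * h) = |dd m A a h| := by
  have h0 : (0 : ℝ) < h := by exact_mod_cast hh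
  have e1 := GG_add_block A a h
  have e2 := GG_add_block A (a + h) h
  have : dd m A a h = (blockCount m A (a + 1) h : ℝ) - blockCount m A (a + 1 + h) h := by
    unfold dd
    rw [show a + 2 * h = a + h + h by ring, e2, e1, show a + h + 1 = a + 1 + h by ring]
    push_cast; ring
  rw [this]
  unfold imbalance blockDensity
  rw [Nat.mul_div_cancel_left h (by norm_num), ← sub_div, abs_div, abs_of_pos h0]
  field_simp

theorem adj_nonneg (c ε : ℝ) {m : ℕ} (A : Fin m → Bool) (p j : ℕ) :
    0 ≤ adjImbalance c ε m A p j := by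
  unfold adjImbalance imbalance; split_ifs
  · exact abs_nonneg _
  · exact le_rfl

theorem pointwise (c ε L : ℝ) (hc : 0 < c) (hε : 0 < ε) (hL : 0 < L) {m : ℕ} (A : Fin m → Bool)
    (a h : ℕ) (hh : 1 ≤ h) :
    1 ≤ ind (QQ m A a h ∧ |dd m A a h| < L) + hole m A a + hole m A (a + h) + hole m A (a + 2 * h)
      + (8 / (3 * h)) * ((h : ℝ) - blockCount m A (a + 1) h)
      + (1 / ((2 * h) * (c * ε))) * (((2 * h : ℕ) : ℝ) - blockCount m A (a + 1) (2 * h))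
      + (h / L) * adjImbalance c ε m A (a + 1) (2 * h) := by
  have h0 : (0 : ℝ) < h := by exact_mod_cast hh
  have n0 := ind_nonneg (QQ m A a h ∧ |dd m A a h| < L)
  have n1 := hole_nonneg m A a
  have n2 := hole_nonneg m A (a + h)
  have n3 := hole_nonneg m A (a + 2 * h)
  have hce : 0 < c * ε := by positivity
  have b1 : (0 : ℝ) ≤ (h : ℝ) - blockCount m A (a + 1) h := by
    have := blockCount_le A (a + 1) h
    rw [sub_nonneg]; exact_mod_cast this
  have b2 : (0 : ℝ) ≤ ((2 * h : ℕ) : ℝ) - blockCount m A (a + 1) (2 * h) := by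
    have := blockCount_le A (a + 1) (2 * h)
    rw [sub_nonneg]; exact_mod_cast this
  have n4 : 0 ≤ (8 / (3 * h)) * ((h : ℝ) - blockCount m A (a + 1) h) := by positivity
  have n5 : 0 ≤ (1 / ((2 * h) * (c * ε))) *
    (((2 * h : ℕ) : ℝ) - blockCount m A (a + 1) (2 * h)) := by positivity
  have n6 : 0 ≤ (h / L) * adjImbalance c ε m A (a + 1) (2 * h) := by
    have := adj_nonneg c ε A (a + 1) (2 * h); positivity
  by_cases c1 : cyc m A a = true
  swap
  · have : hole m A a = 1 := ind_pos c1
    linarith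
  by_cases c2 : cyc m A (a + h) = true
  swap
  · have : hole m A (a + h) = 1 := ind_pos c2
    linarith
  by_cases c3 : cyc m A (a + 2 * h) = true
  swap
  · have : hole m A (a + 2 * h) = 1 := ind_pos c3
    linarith
  by_cases c4 : 5 * h ≤ 8 * blockCount m A (a + 1) h
  swap
  · have : 1 ≤ (8 / (3 * h)) * ((h : ℝ) - blockCount m A (a + 1) h) := by
      rw [div_mul_eq_mul_div, le_div_iff₀ (by positivity)]
      have : (8 * blockCount m A (a + 1) h : ℝ) < 5 * h := by exact_mod_cast (not_le.1 c4)
      linarith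
    linarith
  by_cases c5 : |dd m A a h| < L
  · have : ind (QQ m A a h ∧ |dd m A a h| < L) = 1 := ind_pos ⟨⟨c1, c2, c3, c4⟩, c5⟩
    linarith
  by_cases c6 : IsLive c ε m A (a + 1) (2 * h)
  · have : 1 ≤ (h / L) * adjImbalance c ε m A (a + 1) (2 * h) := by
      unfold adjImbalance
      rw [if_pos c6, div_mul_eq_mul_div, imb_eq A a h hh, le_div_iff₀ hL]
      linarith
    linarith
  · have : 1 ≤ (1 / ((2 * h) * (c * ε))) *
        (((2 * h : ℕ) : ℝ) - blockCount m A (a + 1) (2 * h)) := by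
      unfold IsLive blockDensity at c6
      rw [not_le, div_lt_iff₀ (by push_cast; positivity)] at c6
      rw [div_mul_eq_mul_div, le_div_iff₀ (by positivity)]
      push_cast at c6 ⊢
      linarith
    linarith

theorem count_Q {m n : ℕ} (c ε L : ℝ) (hc : 100 ≤ c) (hε : 0 < ε) (hεc : ε ≤ 1 / c)
    (hmn : (m : ℝ) - n = ε * m) (hL : 0 < L) (A : Config m n) (h N : ℕ) (hh : 1 ≤ h)
    (hN : N + 2 * h ≤ m) :
    (N : ℝ) ≤ ∑ a ∈ Finset.range N, ind (QQ m A.1 a h ∧ |dd m A.1 a h| < L) +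
      (m : ℝ) * (20 / 3 / 100) + (h * m / L) * DeltaAvg c ε m A.1 (2 * h) := by
  have h0 : (0 : ℝ) < h := by exact_mod_cast hh
  have hc0 : 0 < c := by linarith
  have s := Finset.sum_le_sum (s := Finset.range N)
    (fun a _ => pointwise c ε L hc0 hε hL A.1 a h hh)
  simp only [Finset.sum_add_distrib, ← Finset.mul_sum] at s
  rw [Finset.sum_const, Finset.card_range, nsmul_eq_mul, mul_one] at s
  have t1 := sum_shift_le (hole m A.1) (hole_nonneg _ _) N 0 m (by omega)
  have t2 := sum_shift_le (hole m A.1) (hole_nonneg _ _) N h m (by omega)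
  have t3 := sum_shift_le (hole m A.1) (hole_nonneg _ _) N (2 * h) m (by omega)
  simp only [add_zero] at t1
  rw [sum_hole A, hmn] at t1 t2 t3
  have t4 := sum_block_holes A N h (by omega)
  have t5 := sum_block_holes A N (2 * h) (by omega)
  rw [hmn] at t4 t5
  have t6 := sum_shift_le (fun p => adjImbalance c ε m A.1 p (2 * h))
    (fun x => adj_nonneg _ _ _ _ _) N 1 m (by omega)
  have m0 : (0 : ℝ) < m := by
    have : 0 < m := by omega
    exact_mod_cast this
  have e6 : ∑ p ∈ Finset.range m, adjImbalance c ε m A.1 p (2 * h)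
      = m * DeltaAvg c ε m A.1 (2 * h) := by
    unfold DeltaAvg; field_simp
  rw [e6] at t6
  have u4 := mul_le_mul_of_nonneg_left t4 (show (0 : ℝ) ≤ 8 / (3 * h) by positivity)
  have u5 := mul_le_mul_of_nonneg_left t5 (show (0 : ℝ) ≤ 1 / ((2 * h) * (c * ε)) by positivity)
  have u6 := mul_le_mul_of_nonneg_left t6 (show (0 : ℝ) ≤ h / L by positivity)
  have v4 : (8 / (3 * h)) * ((h : ℝ) * (ε * m)) = 8 / 3 * (ε * m) := by field_simp
  have v5 : (1 / ((2 * h) * (c * ε))) * (((2 * h : ℕ) : ℝ) * (ε * m)) = m * (1 / c) := by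
    push_cast; field_simp
  have v6 : (h / L) * (m * DeltaAvg c ε m A.1 (2 * h)) =
    (h * m / L) * DeltaAvg c ε m A.1 (2 * h) := by ring
  rw [v4] at u4
  rw [v5] at u5
  rw [v6] at u6
  have w1 : 1 / c ≤ 1 / 100 := one_div_le_one_div_of_le (by norm_num) hc
  have w2 : m * (1 / c) ≤ m * (1 / 100) := mul_le_mul_of_nonneg_left w1 m0.le
  have w3 : ε * m ≤ (1 / 100) * m := mul_le_mul_of_nonneg_right (by linarith) m0.le
  linarith

theorem count_r {m n : ℕ} (A : Fin m → Bool) (a i : ℕ) (hn : a + 2 * 2 ^ i + 1 ≤ n)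
    (hQ : QQ m A a (2 ^ i)) :
    ((2 ^ i : ℕ) : ℝ) / 4 ≤ ∑ r ∈ Finset.Icc 1 (n + 1), ind (Good m A r a (2 ^ i)) := by
  obtain ⟨q1, q2, q3, q4⟩ := hQ
  have hg := GG_le A a
  have e1 := GG_add_block A a (2 ^ i)
  have key : ∀ lo hi : ℕ, 1 ≤ lo → 2 ^ i ≤ 4 * lo → 2 * hi ≤ 2 ^ i + 1 → 2 ^ i ≤ 4 * (hi + 1 - lo) →
      ((2 ^ i : ℕ) : ℝ) / 4 ≤ ∑ r ∈ Finset.Icc 1 (n + 1), ind (Good m A r a (2 ^ i)) := by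
    intro lo hi k1 k2 k3 k4
    have s1 : ∑ r ∈ Finset.Icc (GG m A a + lo) (GG m A a + hi), ind (Good m A r a (2 ^ i)) ≤
        ∑ r ∈ Finset.Icc 1 (n + 1), ind (Good m A r a (2 ^ i)) := by
      apply Finset.sum_le_sum_of_subset_of_nonneg
      · intro x hx
        simp only [Finset.mem_Icc] at hx ⊢
        omega
      · intro x _ _; exact ind_nonneg _
    have s2 : ∑ r ∈ Finset.Icc (GG m A a + lo) (GG m A a + hi), ind (Good m A r a (2 ^ i)) =
        ∑ r ∈ Finset.Icc (GG m A a + lo) (GG m A a + hi), (1 : ℝ) := by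
      refine Finset.sum_congr rfl fun r hr => ind_pos ?_
      rw [Finset.mem_Icc] at hr
      exact ⟨q1, q2, q3, by omega, by omega, by omega⟩
    rw [s2] at s1
    refine le_trans ?_ s1
    simp only [Finset.sum_const, Nat.card_Icc, nsmul_eq_mul, mul_one]
    rw [div_le_iff₀ (by norm_num)]
    have : 2 ^ i ≤ (GG m A a + hi + 1 - (GG m A a + lo)) * 4 := by omega
    exact_mod_cast this
  rcases i with _ | _ | i
  · exact key 1 1 (by norm_num) (by norm_num) (by norm_num) (by norm_num)
  · exact key 1 1 (by norm_num) (by norm_num) (by norm_num) (by norm_num)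
  · have : 2 ^ (i + 1 + 1) = 4 * 2 ^ i := by ring
    have : 1 ≤ 2 ^ i := Nat.one_le_two_pow
    exact key (2 ^ i) (2 * 2 ^ i) (by omega) (by omega) (by omega) (by omega)

theorem DeltaExp_nonneg (c : ℝ) {m n : ℕ} (Mo : HIModel m n) (j : ℕ) : 0 ≤ DeltaExp c Mo j := by
  unfold DeltaExp
  rw [← pexp_const Mo.C0 0]
  apply pexp_mono
  intro A
  unfold DeltaAvg
  have : 0 ≤ ∑ p ∈ Finset.range m, adjImbalance c (1 - (n : ℝ) / m) m A.1 p j :=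
    Finset.sum_nonneg fun p _ => adj_nonneg _ _ _ _ _
  positivity

theorem count_main {m n : ℕ} (c : ℝ) (hc : 100 ≤ c) (hm : 1000 ≤ m)
    (hε : 0 < 1 - (n : ℝ) / m) (hεc : 1 - (n : ℝ) / m ≤ 1 / c) (Mo : HIModel m n) (i : ℕ)
    (hN : m / 4 + 2 * 2 ^ i ≤ m) (hn : m / 4 + 2 * 2 ^ i + 1 ≤ n) :
    ((2 ^ i : ℕ) : ℝ) / 4 * (m / 8) ≤ ∑ r ∈ Finset.Icc 1 (n + 1), ∑ a ∈ Finset.range (m / 4),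
      pexp Mo.C0 (fun A => ind (Good m A.1 r a (2 ^ i) ∧ |dd m A.1 a (2 ^ i)| <
        100 * (((2 ^ i : ℕ) : ℝ) * DeltaExp c Mo (2 * 2 ^ i) + 1))) := by
  have hD := DeltaExp_nonneg c Mo (2 * 2 ^ i)
  have m0 : (1000 : ℝ) ≤ m := by exact_mod_cast hm
  have mp : (0 : ℝ) < m := by linarith
  have hh : 1 ≤ 2 ^ i := Nat.one_le_two_pow
  have hmn : (m : ℝ) - n = (1 - (n : ℝ) / m) * m := by field_simp
  have h0 : (0 : ℝ) < ((2 ^ i : ℕ) : ℝ) := by exact_mod_cast hh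
  generalize hhd : 2 ^ i = h at *
  set D := DeltaExp c Mo (2 * h) with hDd
  set L := 100 * ((h : ℝ) * D + 1) with hLd
  have hL : 0 < L := by positivity
  rw [Finset.sum_comm]
  simp only [← pexp_sum]
  have step : pexp Mo.C0 (fun A => (h : ℝ) / 4 * ∑ a ∈ Finset.range (m / 4),
      ind (QQ m A.1 a h ∧ |dd m A.1 a h| < L)) ≤
      pexp Mo.C0 (fun A => ∑ a ∈ Finset.range (m / 4), ∑ r ∈ Finset.Icc 1 (n + 1),
        ind (Good m A.1 r a h ∧ |dd m A.1 a h| < L)) := by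
    apply pexp_mono
    intro A
    rw [Finset.mul_sum]
    apply Finset.sum_le_sum
    intro a ha
    rw [Finset.mem_range] at ha
    by_cases hq : QQ m A.1 a h ∧ |dd m A.1 a h| < L
    · rw [ind_pos hq, mul_one]
      have := count_r (n := n) A.1 a i (by rw [hhd]; omega) (by rw [hhd]; exact hq.1)
      rw [hhd] at this
      refine this.trans (le_of_eq ?_)
      refine Finset.sum_congr rfl fun r _ => ?_
      congr 1
      simp [hq.2]
    · rw [ind_neg hq, mul_zero]
      exact Finset.sum_nonneg fun r _ => ind_nonneg _
  refine le_trans ?_ step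
  rw [pexp_mul]
  apply mul_le_mul_of_nonneg_left _ (by positivity)
  have cq := pexp_mono Mo.C0 (fun A => count_Q c _ L hc hε hεc hmn hL A h (m / 4) hh hN)
  rw [pexp_const, pexp_add, pexp_add, pexp_const, pexp_mul] at cq
  have hDD : pexp Mo.C0 (fun A => DeltaAvg c (1 - (n : ℝ) / m) m A.1 (2 * h)) = D := rfl
  rw [hDD] at cq
  have q1 : (h * m / L) * D ≤ m / 100 := by
    rw [div_mul_eq_mul_div, div_le_div_iff₀ hL (by norm_num), hLd]
    nlinarith
  have q2 : (m : ℝ) / 4 - 1 ≤ ((m / 4 : ℕ) : ℝ) := by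
    have : m ≤ 4 * (m / 4) + 4 := by omega
    have : (m : ℝ) ≤ 4 * ((m / 4 : ℕ) : ℝ) + 4 := by exact_mod_cast this
    linarith
  linarith

theorem sum_Jset (m : ℕ) (g : ℕ → ℝ) :
    ∑ j ∈ Jset m, g j = ∑ i ∈ Finset.range (Nat.log 2 m - 2), g (2 * 2 ^ i) := by
  unfold Jset
  rw [Finset.sum_image (fun a _ b _ h => Nat.pow_right_injective (le_refl 2) h)]
  rw [Finset.range_eq_Ico]
  have := Finset.sum_Ico_add' (fun i => g (2 ^ i)) 0 (Nat.log 2 m - 2) 1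
  have e : Finset.Icc 1 (Nat.log 2 m - 2) = Finset.Ico (0 + 1) (Nat.log 2 m - 2 + 1) := by
    ext x; simp only [Finset.mem_Icc, Finset.mem_Ico]; omega
  rw [e, ← this]
  exact Finset.sum_congr rfl fun i _ => by rw [pow_succ, mul_comm]

theorem statement17 :
    ∃ c₀ : ℝ, 10 ≤ c₀ ∧ ∃ κ : ℝ, 0 < κ ∧
      ∀ c : ℝ, c₀ ≤ c → ∃ M : ℕ, ∀ m : ℕ, M ≤ m →
      ∀ n : ℕ, n ≤ m →
      ((m : ℝ) ^ (-(1 : ℝ) / 3) ≤ 1 - (n : ℝ) / m) → (1 - (n : ℝ) / m ≤ 1 / c) →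
      ∀ Mo : HIModel m n,
      κ * ∑ j ∈ Jset m, 1 / (DeltaExp c Mo j + 1 / j) ≤
        (1 / ((Finset.Icc 1 (n + 1)).card : ℝ)) *
          ∑ r ∈ Finset.Icc 1 (n + 1), expPairCost Mo r := by
  refine ⟨100, by norm_num, 1 / 400000, by norm_num, ?_⟩
  intro c hc
  refine ⟨1000, ?_⟩
  intro m hm n hnm hlow hup Mo
  have m0 : (1000 : ℝ) ≤ m := by exact_mod_cast hm
  have mp : (0 : ℝ) < m := by linarith
  have hε : 0 < 1 - (n : ℝ) / m := lt_of_lt_of_le (Real.rpow_pos_of_pos mp _) hlow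
  have hn9 : 9 * m ≤ 10 * n := by
    have w1 : 1 / c ≤ 1 / 100 := one_div_le_one_div_of_le (by norm_num) hc
    have : 9 / 10 ≤ (n : ℝ) / m := by linarith
    rw [div_le_div_iff₀ (by norm_num) mp] at this
    have h2 : (9 * m : ℝ) ≤ 10 * n := by linarith
    exact_mod_cast h2
  have hK : ∀ i < Nat.log 2 m - 2, 8 * 2 ^ i ≤ m := by
    intro i hi
    have h1 : 2 ^ Nat.log 2 m ≤ m := Nat.pow_log_le_self 2 (by omega)
    have h2 : 2 ^ (i + 3) ≤ 2 ^ Nat.log 2 m := Nat.pow_le_pow_right (by norm_num) (by omega)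
    rw [pow_add] at h2
    omega
  have hD := fun i : ℕ => DeltaExp_nonneg c Mo (2 * 2 ^ i)
  let L : ℕ → ℝ := fun i => 100 * (((2 ^ i : ℕ) : ℝ) * DeltaExp c Mo (2 * 2 ^ i) + 1)
  have hL : ∀ i, 0 ≤ L i := fun i => by
    have := hD i
    positivity
  have cost : ∀ r ∈ Finset.Icc 1 (n + 1), _ := fun r hr =>
    cost_bound (N := m / 4) (K := Nat.log 2 m - 2) Mo r (Finset.mem_Icc.1 hr).1
      (Finset.mem_Icc.1 hr).2
      (fun i hi a ha => by have := hK i hi; omega)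
      (fun i hi a ha => by have := hK i hi; omega) L hL
  have tot := Finset.sum_le_sum cost
  rw [Finset.sum_comm, ← Finset.mul_sum] at tot
  have low : ∑ i ∈ Finset.range (Nat.log 2 m - 2),
      (1 / (2 * L i + 2)) * (((2 ^ i : ℕ) : ℝ) / 4 * (m / 8)) ≤
      15 * ∑ r ∈ Finset.Icc 1 (n + 1), expPairCost Mo r := by
    refine le_trans (Finset.sum_le_sum fun i hi => ?_) tot
    simp only [← Finset.mul_sum]
    rw [Finset.mem_range] at hi
    have := hK i hi
    have hp : 0 ≤ 1 / (2 * L i + 2) := by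
      have := hL i
      positivity
    exact mul_le_mul_of_nonneg_left (count_main c hc hm hε hup Mo i (by omega) (by omega)) hp
  rw [sum_Jset m (fun j => 1 / (DeltaExp c Mo j + 1 / j))]
  have term : ∀ i ∈ Finset.range (Nat.log 2 m - 2),
      (m : ℝ) / 12928 * (1 / (DeltaExp c Mo (2 * 2 ^ i) + 1 / ((2 * 2 ^ i : ℕ) : ℝ))) ≤
      (1 / (2 * L i + 2)) * (((2 ^ i : ℕ) : ℝ) / 4 * (m / 8)) := by
    intro i _
    have h0 : (0 : ℝ) < ((2 ^ i : ℕ) : ℝ) := by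
      have : 0 < 2 ^ i := Nat.two_pow_pos i
      exact_mod_cast this
    have hDi := hD i
    simp only [L]
    rw [Nat.cast_mul]
    generalize ((2 ^ i : ℕ) : ℝ) = h at *
    generalize DeltaExp c Mo (2 * 2 ^ i) = D at *
    have e1 : 1 / (D + 1 / (((2 : ℕ) : ℝ) * h)) = 2 * h / (2 * h * D + 1) := by
      push_cast; field_simp
    rw [e1]
    have e2 : (m : ℝ) / 12928 * (2 * h / (2 * h * D + 1)) = (m * h / 6464) / (2 * h * D + 1) := by
      ring
    have e3 : (1 / (2 * (100 * (h * D + 1)) + 2)) * (h / 4 * (m / 8)) =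
        (m * h / 6464) / ((2 * (100 * (h * D + 1)) + 2) / 202) := by
      field_simp; norm_num
    rw [e2, e3]
    have : 0 ≤ h * D := by positivity
    apply div_le_div_of_nonneg_left (by positivity) (by positivity)
    linarith
  have fin := (Finset.sum_le_sum term).trans low
  rw [← Finset.mul_sum] at fin
  have S0 : 0 ≤ ∑ i ∈ Finset.range (Nat.log 2 m - 2),
      (1 / (DeltaExp c Mo (2 * 2 ^ i) + 1 / ((2 * 2 ^ i : ℕ) : ℝ))) := by
    apply Finset.sum_nonneg
    intro i _
    have := hD i
    positivity
  generalize ∑ i ∈ Finset.range (Nat.log 2 m - 2),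
      (1 / (DeltaExp c Mo (2 * 2 ^ i) + 1 / ((2 * 2 ^ i : ℕ) : ℝ))) = S at *
  generalize ∑ r ∈ Finset.Icc 1 (n + 1), expPairCost Mo r = T at *
  have hcard : ((Finset.Icc 1 (n + 1)).card : ℝ) = n + 1 := by simp
  have hnr : (n : ℝ) ≤ m := by exact_mod_cast hnm
  have hn0 : (0 : ℝ) < (n : ℝ) + 1 := by positivity
  rw [hcard, one_div ((n : ℝ) + 1), le_inv_mul_iff₀ hn0]
  have hx : (n + 1 : ℝ) * S ≤ 2 * m * S := mul_le_mul_of_nonneg_right (by linarith) S0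
  have hy : 0 ≤ (m : ℝ) * S := by positivity
  linarith
end

section
/- Let S be a finite set and let (h_x)_{x ∈ S} be independent random variables, each uniformly distributed on [0, 1]. Then for all nonempty subsets C, C' ⊆ S, the probability that the minimizer of h over C differs from the minimizer of h over C' is at most |C Δ C'|/(|C ∩ C'| + 1), where C Δ C' denotes the symmetric difference. (Almost surely all values h_x are distinct, so the minimizers are almost surely unique.) -/
open MeasureTheory ProbabilityTheory

theorem aux_symm {S : Type*} [Fintype S] [DecidableEq S]
    {Ω : Type*} [MeasurableSpace Ω] (μ : Measure Ω) [IsProbabilityMeasure μ]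
    (h : S → Ω → ℝ) (hmeas : ∀ x, Measurable (h x))
    (hindep : iIndepFun h μ)
    (hunif : ∀ x, μ.map (h x) = volume.restrict (Set.Icc (0 : ℝ) 1))
    (T : Finset S) (z w : S) (hz : z ∈ T) (hw : w ∈ T) :
    μ {ω | ∀ y ∈ T, y ≠ w → h w ω < h y ω} = μ {ω | ∀ y ∈ T, y ≠ z → h z ω < h y ω} := by
  set σ := Equiv.swap z w with hσ
  have hind2 : iIndepFun (fun x => h (σ x)) μ := hindep.precomp σ.injective
  have e1 := (iIndepFun_iff_map_fun_eq_pi_map (fun x => (hmeas x).aemeasurable)).1 hindep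
  have e2 := (iIndepFun_iff_map_fun_eq_pi_map (fun x => (hmeas (σ x)).aemeasurable)).1 hind2
  simp only [hunif] at e1 e2
  have hA : MeasurableSet {f : S → ℝ | ∀ y ∈ T, y ≠ z → f z < f y} := by
    have : {f : S → ℝ | ∀ y ∈ T, y ≠ z → f z < f y}
        = ⋂ y ∈ T, ⋂ (_ : y ≠ z), {f : S → ℝ | f z < f y} := by
      ext f; simp
    rw [this]
    refine Finset.measurableSet_biInter _ fun y _ => MeasurableSet.iInter fun _ => ?_
    exact measurableSet_lt (measurable_pi_apply z) (measurable_pi_apply y)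
  have key := congrArg (fun m => m {f : S → ℝ | ∀ y ∈ T, y ≠ z → f z < f y}) (e2.trans e1.symm)
  rw [Measure.map_apply (measurable_pi_lambda _ fun x => hmeas (σ x)) hA,
    Measure.map_apply (measurable_pi_lambda _ fun x => hmeas x) hA] at key
  simp only [Set.preimage_setOf_eq] at key
  rw [← key]
  congr 1
  ext ω
  simp only [Set.mem_setOf_eq]
  have hT : ∀ y ∈ T, σ y ∈ T := by
    intro y hy
    rw [hσ, Equiv.swap_apply_def]
    split_ifs <;> assumption
  have hσz : σ z = w := Equiv.swap_apply_left z w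
  constructor
  · intro H y hy hyz
    rw [hσz]
    refine H _ (hT y hy) fun e => hyz (σ.injective (e.trans hσz.symm))
  · intro H y hy hyw
    have := H (σ y) (hT y hy) (fun e => hyw (by
      have h2 : σ (σ y) = y := Equiv.swap_apply_self z w y
      rw [← h2, e, hσz]))
    have h2 : σ (σ y) = y := Equiv.swap_apply_self z w y
    rwa [hσz, h2] at this

theorem aux_bound {S : Type*} [Fintype S] [DecidableEq S]
    {Ω : Type*} [MeasurableSpace Ω] (μ : Measure Ω) [IsProbabilityMeasure μ]
    (h : S → Ω → ℝ) (hmeas : ∀ x, Measurable (h x))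
    (hindep : iIndepFun h μ)
    (hunif : ∀ x, μ.map (h x) = volume.restrict (Set.Icc (0 : ℝ) 1))
    (T : Finset S) (z : S) (hz : z ∈ T) :
    μ {ω | ∀ y ∈ T, y ≠ z → h z ω < h y ω} ≤ (T.card : ENNReal)⁻¹ := by
  have hd : μ (⋃ w ∈ T, {ω | ∀ y ∈ T, y ≠ w → h w ω < h y ω})
      = ∑ w ∈ T, μ {ω | ∀ y ∈ T, y ≠ w → h w ω < h y ω} := by
    refine measure_biUnion_finset ?_ ?_
    · intro a ha b hb hab
      refine Set.disjoint_left.2 fun ω h1 h2 => ?_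
      exact lt_asymm (h1 b hb hab.symm) (h2 a ha hab)
    · intro w _
      have : {ω | ∀ y ∈ T, y ≠ w → h w ω < h y ω}
          = ⋂ y ∈ T, ⋂ (_ : y ≠ w), {ω | h w ω < h y ω} := by
        ext f; simp
      rw [this]
      refine Finset.measurableSet_biInter _ fun y _ => MeasurableSet.iInter fun _ => ?_
      exact measurableSet_lt (hmeas w) (hmeas y)
  rw [Finset.sum_congr rfl (fun w hw => aux_symm μ h hmeas hindep hunif T z w hz hw),
    Finset.sum_const, nsmul_eq_mul] at hd
  have h1 := hd.symm.le.trans prob_le_one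
  rw [mul_comm] at h1
  exact (ENNReal.le_inv_iff_mul_le).2 h1

/-- For independent `Uniform[0,1]` hashes `(h x)_{x ∈ S}` and nonempty finite
sets `C, C' ⊆ S`, the probability that the minimizer of `h` over `C` differs
from the minimizer over `C'` is at most `|C Δ C'| / (|C ∩ C'| + 1)`. -/
theorem statement19 {S : Type*} [Fintype S] [DecidableEq S]
    {Ω : Type*} [MeasurableSpace Ω] (μ : Measure Ω) [IsProbabilityMeasure μ]
    (h : S → Ω → ℝ) (hmeas : ∀ x, Measurable (h x))
    (hindep : iIndepFun h μ)
    (hunif : ∀ x, μ.map (h x) = volume.restrict (Set.Icc (0 : ℝ) 1))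
    (C C' : Finset S) (hC : C.Nonempty) (hC' : C'.Nonempty) :
    μ {ω | ¬ ∃ x, x ∈ C ∩ C' ∧ (∀ y ∈ C, h x ω ≤ h y ω) ∧ (∀ y ∈ C', h x ω ≤ h y ω)}
      ≤ ENNReal.ofReal ((((symmDiff C C').card : ℝ)) / (((C ∩ C').card : ℝ) + 1)) := by
  classical
  have hR : ENNReal.ofReal ((((symmDiff C C').card : ℝ)) / (((C ∩ C').card : ℝ) + 1))
      = ∑ z ∈ symmDiff C C', (((C ∩ C').card + 1 : ℕ) : ENNReal)⁻¹ := by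
    rw [Finset.sum_const, nsmul_eq_mul, ENNReal.ofReal_div_of_pos (by positivity),
      ENNReal.ofReal_natCast, div_eq_mul_inv]
    congr 2
    rw [← ENNReal.ofReal_natCast]
    push_cast
    rfl
  rw [hR]
  have hsub : {ω | ¬ ∃ x, x ∈ C ∩ C' ∧ (∀ y ∈ C, h x ω ≤ h y ω) ∧ (∀ y ∈ C', h x ω ≤ h y ω)}
      ⊆ ⋃ z ∈ symmDiff C C', {ω | ∀ y ∈ insert z (C ∩ C'), y ≠ z → h z ω < h y ω} := by
    intro ω hω
    by_contra hcon
    apply hω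
    simp only [Set.mem_iUnion, Set.mem_setOf_eq, not_exists, Finset.mem_insert] at hcon
    have hne : (C ∩ C').Nonempty := by
      by_contra hemp
      rw [Finset.not_nonempty_iff_eq_empty] at hemp
      obtain ⟨c, hc⟩ := hC
      have hc' : c ∉ C' := fun hh => by
        have : c ∈ C ∩ C' := Finset.mem_inter.2 ⟨hc, hh⟩
        simp [hemp] at this
      refine hcon c (Finset.mem_symmDiff.2 (Or.inl ⟨hc, hc'⟩)) ?_
      rintro y (rfl | hy) hyc
      · exact absurd rfl hyc
      · simp [hemp] at hy
    obtain ⟨x, hx, hmin⟩ := Finset.exists_min_image (C ∩ C') (fun x => h x ω) hne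
    have hs : ∀ z ∈ symmDiff C C', h x ω ≤ h z ω := by
      intro z hz
      by_contra hlt
      push Not at hlt
      refine hcon z hz ?_
      rintro y (rfl | hy) hyc
      · exact absurd rfl hyc
      · exact hlt.trans_le (hmin y hy)
    refine ⟨x, hx, fun y hy => ?_, fun y hy => ?_⟩
    · by_cases hy' : y ∈ C'
      · exact hmin y (Finset.mem_inter.2 ⟨hy, hy'⟩)
      · exact hs y (Finset.mem_symmDiff.2 (Or.inl ⟨hy, hy'⟩))
    · by_cases hy' : y ∈ C
      · exact hmin y (Finset.mem_inter.2 ⟨hy', hy⟩)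
      · exact hs y (Finset.mem_symmDiff.2 (Or.inr ⟨hy, hy'⟩))
  refine (measure_mono hsub).trans ((measure_biUnion_finset_le _ _).trans ?_)
  refine Finset.sum_le_sum fun z hz => ?_
  have hb := aux_bound μ h hmeas hindep hunif (insert z (C ∩ C')) z (Finset.mem_insert_self _ _)
  have hzn : z ∉ C ∩ C' := by
    rw [Finset.mem_symmDiff] at hz
    rw [Finset.mem_inter]
    tauto
  rwa [Finset.card_insert_of_notMem hzn] at hb
end
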